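/- There exists a constant C > 0, depending only on d and φ, such that for every 0 < ε < 1, every ε-thin set S ⊆ ℝ^d, every integer N ≥ 0 and every x ∈ ℝ^d, ∫_S |A_N(x,y)| dy ≤ Cε. -/

import Mathlib

open MeasureTheory Metric
open scoped RealInnerProductSpace Pointwise ENNReal NNReal Convolution

/-- The Fourier transform `𝓕f(ξ) = (2π)^{-d/2} ∫ f(x) e^{-i⟨x,ξ⟩} dx` on `ℝ^d`. -/
noncomputable def fourierInt {d : ℕ} (f : EuclideanSpace ℝ (Fin d) → ℂ)
    (ξ : EuclideanSpace ℝ (Fin d)) : ℂ :=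
  (((2 * Real.pi) ^ (-(d : ℝ) / 2) : ℝ) : ℂ) *
    ∫ x, f x * Complex.exp (-Complex.I * ((⟪x, ξ⟫ : ℝ) : ℂ))

/-- The dilations `φ_j(x) = 2^{jd} φ(2^j x)`. -/
noncomputable def phij {d : ℕ} (φ : EuclideanSpace ℝ (Fin d) → ℂ) (j : ℕ) :
    EuclideanSpace ℝ (Fin d) → ℂ :=
  fun x => (2 : ℂ) ^ (j * d) * φ ((2 : ℝ) ^ j • x)

/-- `ψ_0 = 𝓕φ` and `ψ_j = 𝓕φ_j - 𝓕φ_{j-1}` for `j ≥ 1`. -/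
noncomputable def psij {d : ℕ} (φ : EuclideanSpace ℝ (Fin d) → ℂ) (j : ℕ) :
    EuclideanSpace ℝ (Fin d) → ℂ :=
  fun ξ => if j = 0 then fourierInt φ ξ
    else fourierInt (phij φ j) ξ - fourierInt (phij φ (j - 1)) ξ

/-- The kernel `A_N(x,y) = ∑_{j=0}^N ψ_j(x) φ_j(y-x)`. -/
noncomputable def AN {d : ℕ} (φ : EuclideanSpace ℝ (Fin d) → ℂ) (N : ℕ)
    (x y : EuclideanSpace ℝ (Fin d)) : ℂ :=
  ∑ j ∈ Finset.range (N + 1), psij φ j x * phij φ j (y - x)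

open Classical in
/-- `ρ(x) = min(1, |x|⁻¹)`, with `ρ(0) = 1`. -/
noncomputable def rho {d : ℕ} (x : EuclideanSpace ℝ (Fin d)) : ℝ :=
  if x = 0 then 1 else min 1 ‖x‖⁻¹

/-- A measurable set `S ⊆ ℝ^d` is `ε`-thin if
`|S ∩ B(x, ρ(x))| ≤ ε |B(x, ρ(x))|` for every `x`. -/
def IsThin {d : ℕ} (ε : ℝ) (S : Set (EuclideanSpace ℝ (Fin d))) : Prop :=
  MeasurableSet S ∧ ∀ x : EuclideanSpace ℝ (Fin d),
    volume (S ∩ closedBall x (rho x)) ≤ ENNReal.ofReal ε * volume (closedBall x (rho x))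

section
variable {d : ℕ}

lemma rho_pos (x : EuclideanSpace ℝ (Fin d)) : 0 < rho x := by
  unfold rho
  split_ifs with h
  · exact one_pos
  · have := norm_pos_iff.2 h
    positivity

lemma rho_le_one (x : EuclideanSpace ℝ (Fin d)) : rho x ≤ 1 := by
  unfold rho
  split_ifs with h
  · exact le_rfl
  · exact min_le_left _ _

lemma rho_mul_norm_le_one (x : EuclideanSpace ℝ (Fin d)) : rho x * ‖x‖ ≤ 1 := by
  unfold rho
  split_ifs with h
  · simp [h]
  · have := norm_pos_iff.2 h
    calc min 1 ‖x‖⁻¹ * ‖x‖ ≤ ‖x‖⁻¹ * ‖x‖ := by gcongr; exact min_le_right _ _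
      _ = 1 := inv_mul_cancel₀ this.ne'

lemma le_rho {x : EuclideanSpace ℝ (Fin d)} {r : ℝ} (h1 : r ≤ 1) (h : r * ‖x‖ ≤ 1) :
    r ≤ rho x := by
  unfold rho
  split_ifs with hx
  · exact h1
  · refine le_min h1 ?_
    rwa [← one_div, le_div_iff₀ (norm_pos_iff.2 hx)]

lemma rho_le_two_mul_rho {y z : EuclideanSpace ℝ (Fin d)} (h : ‖y - z‖ ≤ 1) :
    rho z ≤ 2 * rho y := by
  have h1 := rho_le_one z
  have h0 := rho_pos z
  have h2 := rho_mul_norm_le_one z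
  have h3 : ‖y‖ ≤ ‖z‖ + ‖y - z‖ := norm_le_norm_add_norm_sub' y z
  have : rho z / 2 ≤ rho y := le_rho (by linarith) (by nlinarith)
  linarith

lemma measurable_rho : Measurable (rho : EuclideanSpace ℝ (Fin d) → ℝ) := by
  classical
  unfold rho
  refine Measurable.ite (measurableSet_singleton 0) measurable_const ?_
  fun_prop

lemma volume_closedBall_eq (x : EuclideanSpace ℝ (Fin d)) {r : ℝ} (hr : 0 ≤ r) :
    volume (closedBall x r) =
      ENNReal.ofReal (r ^ d) * volume (ball (0 : EuclideanSpace ℝ (Fin d)) 1) := by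
  simpa using Measure.addHaar_closedBall (volume : Measure (EuclideanSpace ℝ (Fin d))) x hr

lemma measurable_volume_closedBall_rho :
    Measurable fun z : EuclideanSpace ℝ (Fin d) => volume (closedBall z (rho z)) := by
  simp_rw [fun z : EuclideanSpace ℝ (Fin d) => volume_closedBall_eq z (rho_pos z).le]
  have := measurable_rho (d := d)
  fun_prop

/-- The balls `B(z, ρ(z))` containing a given point `y` have total normalized mass bounded below. -/
lemma one_le_lintegral_inv_volume (y : EuclideanSpace ℝ (Fin d)) :
    1 ≤ (4 : ℝ≥0∞) ^ d * ∫⁻ z, {z | y ∈ closedBall z (rho z)}.indicator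
      (fun z => (volume (closedBall z (rho z)))⁻¹) z := by
  set B := closedBall y (rho y / 2)
  have hy := rho_pos y
  have hV0 : volume B ≠ 0 := (measure_closedBall_pos _ _ (by positivity)).ne'
  have hVt : volume B ≠ ∞ := measure_closedBall_lt_top.ne
  have key : ∀ z, B.indicator (fun _ => ((4 : ℝ≥0∞) ^ d * volume B)⁻¹) z ≤
      {z | y ∈ closedBall z (rho z)}.indicator
      (fun z => (volume (closedBall z (rho z)))⁻¹) z := by
    intro z
    by_cases hz : z ∈ B
    · have hz' : ‖z - y‖ ≤ rho y / 2 := by simpa [B, dist_eq_norm] using hz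
      have h1 := rho_le_one y
      have h2 : rho y ≤ 2 * rho z := rho_le_two_mul_rho (by linarith)
      have h3 : rho z ≤ 2 * rho y := rho_le_two_mul_rho (by rw [norm_sub_rev]; linarith)
      have hm : z ∈ {z | y ∈ closedBall z (rho z)} := by
        change dist y z ≤ rho z
        rw [dist_comm, dist_eq_norm]; linarith
      rw [Set.indicator_of_mem hz, Set.indicator_of_mem hm]
      refine ENNReal.inv_le_inv.2 ?_
      rw [volume_closedBall_eq z (rho_pos z).le, volume_closedBall_eq y (by positivity),
        ← mul_assoc]
      gcongr
      have : (4 : ℝ≥0∞) = ENNReal.ofReal 4 := by simp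
      rw [this, ← ENNReal.ofReal_pow (by norm_num), ← ENNReal.ofReal_mul (by positivity),
        ← mul_pow]
      refine ENNReal.ofReal_le_ofReal (pow_le_pow_left₀ (rho_pos z).le (by linarith) _)
    · rw [Set.indicator_of_notMem hz]; exact zero_le
  calc (1 : ℝ≥0∞) = (4 : ℝ≥0∞) ^ d * (((4 : ℝ≥0∞) ^ d * volume B)⁻¹ * volume B) := by
        rw [mul_left_comm, ENNReal.inv_mul_cancel]
        · exact mul_ne_zero (by simp) hV0
        · exact ENNReal.mul_ne_top (by simp) hVt
    _ = (4 : ℝ≥0∞) ^ d * ∫⁻ z, B.indicator (fun _ => ((4 : ℝ≥0∞) ^ d * volume B)⁻¹) z := by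
        rw [lintegral_indicator_const measurableSet_closedBall]
    _ ≤ _ := by gcongr; exact key _

/-- Integrals over thin sets of weights that are almost constant at scale `ρ` are small. -/
lemma IsThin.setLIntegral_le {ε : ℝ} {S : Set (EuclideanSpace ℝ (Fin d))} (hS : IsThin ε S)
    {w : EuclideanSpace ℝ (Fin d) → ℝ≥0∞} (hw : Measurable w) {K : ℝ≥0∞}
    (hK : ∀ z, ∀ y ∈ closedBall z (rho z), w y ≤ K * w z) :
    ∫⁻ y in S, w y ≤ 4 ^ d * (K * ENNReal.ofReal ε) * ∫⁻ y, w y := by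
  let V : EuclideanSpace ℝ (Fin d) → ℝ≥0∞ := fun z => volume (closedBall z (rho z))
  have hVm : Measurable V := measurable_volume_closedBall_rho
  let G : EuclideanSpace ℝ (Fin d) → EuclideanSpace ℝ (Fin d) → ℝ≥0∞ :=
    fun y z => {z | y ∈ closedBall z (rho z)}.indicator (fun z => (V z)⁻¹) z
  have hG : Measurable (Function.uncurry G) := by
    have hs : MeasurableSet {p : EuclideanSpace ℝ (Fin d) × EuclideanSpace ℝ (Fin d) |
        dist p.1 p.2 ≤ rho p.2} :=
      measurableSet_le (by fun_prop) (measurable_rho.comp measurable_snd)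
    exact (hVm.inv.comp measurable_snd).indicator hs
  calc ∫⁻ y in S, w y ≤ ∫⁻ y in S, w y * (4 ^ d * ∫⁻ z, G y z) := by
        refine lintegral_mono fun y => ?_
        exact le_mul_of_one_le_right zero_le (one_le_lintegral_inv_volume y)
    _ = 4 ^ d * ∫⁻ y in S, ∫⁻ z, w y * G y z := by
        rw [← lintegral_const_mul' _ _ (by simp)]
        refine lintegral_congr fun y => ?_
        rw [lintegral_const_mul _ hG.of_uncurry_left, mul_left_comm]
    _ = 4 ^ d * ∫⁻ z, ∫⁻ y in S, w y * G y z := by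
        rw [lintegral_lintegral_swap]
        exact ((hw.comp measurable_fst).mul hG).aemeasurable
    _ ≤ 4 ^ d * ∫⁻ z, (K * ENNReal.ofReal ε) * w z := by
        gcongr with z
        calc ∫⁻ y in S, w y * G y z
            ≤ ∫⁻ y in S, (closedBall z (rho z)).indicator (fun _ => K * w z * (V z)⁻¹) y := by
              refine lintegral_mono fun y => ?_
              by_cases hy : y ∈ closedBall z (rho z)
              · have : z ∈ {z | y ∈ closedBall z (rho z)} := hy
                simp only [G, Set.indicator_of_mem this, Set.indicator_of_mem hy]
                gcongr
                exact hK z y hy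
              · have : z ∉ {z | y ∈ closedBall z (rho z)} := hy
                simp only [G, Set.indicator_of_notMem this, mul_zero]
                exact zero_le
          _ = K * w z * (V z)⁻¹ * volume (S ∩ closedBall z (rho z)) := by
              rw [lintegral_indicator_const measurableSet_closedBall,
                Measure.restrict_apply measurableSet_closedBall, Set.inter_comm]
          _ ≤ K * w z * (V z)⁻¹ * (ENNReal.ofReal ε * V z) := by
              gcongr
              exact hS.2 z
          _ = K * ENNReal.ofReal ε * w z * ((V z)⁻¹ * V z) := by ring
          _ = K * ENNReal.ofReal ε * w z := by
              rw [ENNReal.inv_mul_cancel, mul_one]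
              · exact (measure_closedBall_pos _ _ (rho_pos z)).ne'
              · exact measure_closedBall_lt_top.ne
    _ = _ := by rw [lintegral_const_mul _ hw]; ring

lemma one_add_mul_norm_sub_le {x y z : EuclideanSpace ℝ (Fin d)} {t : ℝ} (ht : 1 ≤ t)
    (htx : t ≤ 1 ∨ t ≤ 2 * ‖x‖) (hy : y ∈ closedBall z (rho z)) :
    1 + t * ‖z - x‖ ≤ 10 * (1 + t * ‖y - x‖) := by
  have hyz : ‖y - z‖ ≤ rho z := by simpa [dist_eq_norm] using hy
  have h1 := rho_le_one z
  have h0 := rho_pos z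
  have h2 := rho_mul_norm_le_one z
  have hb := norm_nonneg (y - x)
  have hz := norm_nonneg z
  have ha : ‖z - x‖ ≤ ‖y - x‖ + rho z := by
    have := norm_sub_le_norm_sub_add_norm_sub z y x
    rw [norm_sub_rev z y] at this
    linarith
  rcases le_or_gt (t * rho z) 9 with h | h
  · nlinarith
  · have ht9 : 9 < t := by nlinarith
    have htx : t ≤ 2 * ‖x‖ := htx.resolve_left (by linarith)
    have hzt : 9 * ‖z‖ < t := by
      by_contra! hc
      nlinarith
    have hx : ‖x‖ ≤ ‖z‖ + ‖z - x‖ := by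
      have := norm_le_norm_add_norm_sub z x
      linarith
    nlinarith

lemma fourierInt_phij (f : EuclideanSpace ℝ (Fin d) → ℂ) (j : ℕ)
    (ξ : EuclideanSpace ℝ (Fin d)) :
    fourierInt (phij f j) ξ = fourierInt f (((2 : ℝ) ^ j)⁻¹ • ξ) := by
  have h := Measure.integral_comp_smul_of_nonneg (volume : Measure (EuclideanSpace ℝ (Fin d)))
    (fun u => f u * Complex.exp (-Complex.I * ((⟪u, ((2 : ℝ) ^ j)⁻¹ • ξ⟫ : ℝ) : ℂ)))
    ((2 : ℝ) ^ j) (hR := by positivity)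
  have h2 : ((2 : ℝ) ^ j) ≠ 0 := by positivity
  simp only [real_inner_smul_left, real_inner_smul_right, inv_mul_cancel_left₀ h2,
    finrank_euclideanSpace, Fintype.card_fin] at h
  unfold fourierInt phij
  simp only [mul_assoc]
  rw [integral_const_mul, h, ← pow_mul]
  simp only [real_inner_smul_right, Complex.real_smul]
  congr 1
  rw [← mul_assoc]
  have : (2 : ℂ) ^ (j * d) * (((2 ^ (j * d))⁻¹ : ℝ) : ℂ) = 1 := by
    push_cast
    exact mul_inv_cancel₀ (pow_ne_zero _ two_ne_zero)
  rw [this, one_mul]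

lemma norm_psij_le {f : EuclideanSpace ℝ (Fin d) → ℂ} (hf : ∀ ξ, ‖fourierInt f ξ‖ ≤ 1)
    (j : ℕ) (x : EuclideanSpace ℝ (Fin d)) : ‖psij f j x‖ ≤ 2 := by
  unfold psij
  split_ifs
  · exact (hf x).trans one_le_two
  · rw [fourierInt_phij, fourierInt_phij]
    exact (norm_sub_le _ _).trans ((add_le_add (hf _) (hf _)).trans one_add_one_eq_two.le)

/-- `ψ_j` lives on the annulus `2^{j-1} ≤ |x| ≤ 2^{j+1}` (on the ball `|x| ≤ 2` for `j = 0`). -/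
lemma norm_bounds_of_psij_ne_zero {f : EuclideanSpace ℝ (Fin d) → ℂ}
    (hsupp : ∀ ξ : EuclideanSpace ℝ (Fin d), 2 < ‖ξ‖ → fourierInt f ξ = 0)
    (hone : ∀ ξ : EuclideanSpace ℝ (Fin d), ‖ξ‖ ≤ 1 → fourierInt f ξ = 1)
    {j : ℕ} {x : EuclideanSpace ℝ (Fin d)} (h : psij f j x ≠ 0) :
    ((2 : ℝ) ^ j ≤ 1 ∨ (2 : ℝ) ^ j ≤ 2 * ‖x‖) ∧ ‖x‖ ≤ 2 * 2 ^ j := by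
  rcases j with _ | k
  · refine ⟨by simp, ?_⟩
    by_contra! hc
    exact h (by simpa [psij] using hsupp x (by simpa using hc))
  · have hk : (0 : ℝ) < 2 ^ k := by positivity
    have hn : ∀ i : ℕ, ‖((2 : ℝ) ^ i)⁻¹ • x‖ = ‖x‖ / 2 ^ i := fun i => by
      rw [norm_smul, norm_inv, norm_pow, Real.norm_ofNat, inv_mul_eq_div]
    have h' : fourierInt f (((2 : ℝ) ^ (k + 1))⁻¹ • x) - fourierInt f (((2 : ℝ) ^ k)⁻¹ • x) ≠ 0 := by
      simpa [psij, fourierInt_phij] using h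
    constructor
    · right
      by_contra! hc
      rw [pow_succ] at hc
      refine h' ?_
      rw [hone _ (by rw [hn, div_le_one (by positivity), pow_succ]; linarith),
        hone _ (by rw [hn, div_le_one (by positivity)]; linarith), sub_self]
    · by_contra! hc
      rw [pow_succ] at hc
      refine h' ?_
      rw [hsupp _ (by rw [hn, lt_div_iff₀ (by positivity), pow_succ]; linarith),
        hsupp _ (by rw [hn, lt_div_iff₀ (by positivity)]; linarith), sub_self]

lemma card_psij_ne_zero_le {f : EuclideanSpace ℝ (Fin d) → ℂ}
    (hsupp : ∀ ξ : EuclideanSpace ℝ (Fin d), 2 < ‖ξ‖ → fourierInt f ξ = 0)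
    (hone : ∀ ξ : EuclideanSpace ℝ (Fin d), ‖ξ‖ ≤ 1 → fourierInt f ξ = 1)
    (s : Finset ℕ) (x : EuclideanSpace ℝ (Fin d)) :
    {j ∈ s | psij f j x ≠ 0}.card ≤ 3 := by
  rcases Finset.eq_empty_or_nonempty {j ∈ s | psij f j x ≠ 0} with he | hne
  · simp [he]
  set J := {j ∈ s | psij f j x ≠ 0}
  set i := J.min' hne
  have hi := (norm_bounds_of_psij_ne_zero hsupp hone
    (Finset.mem_filter.1 (J.min'_mem hne)).2).2
  have hsub : J ⊆ Finset.Icc i (i + 2) := by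
    intro j hj
    refine Finset.mem_Icc.2 ⟨J.min'_le j hj, ?_⟩
    have h := (norm_bounds_of_psij_ne_zero hsupp hone (Finset.mem_filter.1 hj).2).1
    have h1 : (1 : ℝ) ≤ 2 ^ i := one_le_pow₀ one_le_two
    have : (2 : ℝ) ^ j ≤ 2 ^ (i + 2) := by
      rw [pow_add]
      rcases h with h | h <;> linarith
    exact (pow_le_pow_iff_right₀ one_lt_two).1 this
  have := Finset.card_le_card hsub
  rw [Nat.card_Icc] at this
  omega

/-- The `L¹`-normalized weight at scale `2^{-j}` centered at `x` that dominates `φ_j(· - x)`. -/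
noncomputable def japaneseWeight (j : ℕ) (x y : EuclideanSpace ℝ (Fin d)) : ℝ≥0∞ :=
  ENNReal.ofReal (2 ^ (j * d) * (1 + 2 ^ j * ‖y - x‖) ^ (-((d : ℝ) + 1)))

lemma measurable_japaneseWeight (j : ℕ) (x : EuclideanSpace ℝ (Fin d)) :
    Measurable (japaneseWeight j x) := by
  unfold japaneseWeight
  fun_prop

lemma lintegral_japaneseWeight (j : ℕ) (x : EuclideanSpace ℝ (Fin d)) :
    ∫⁻ y, japaneseWeight j x y =
      ∫⁻ u : EuclideanSpace ℝ (Fin d), ENNReal.ofReal ((1 + ‖u‖) ^ (-((d : ℝ) + 1))) := by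
  have h2 : ((2 : ℝ) ^ j) ≠ 0 := by positivity
  have hm : Measurable fun u : EuclideanSpace ℝ (Fin d) =>
      ENNReal.ofReal ((1 + ‖u‖) ^ (-((d : ℝ) + 1))) := by fun_prop
  have h := Measure.map_addHaar_smul (volume : Measure (EuclideanSpace ℝ (Fin d))) h2
  have h3 := lintegral_map (μ := volume) hm
    (measurable_const_smul ((2 : ℝ) ^ j) : Measurable fun u : EuclideanSpace ℝ (Fin d) => _)
  rw [h, lintegral_smul_measure] at h3
  unfold japaneseWeight
  rw [lintegral_sub_right_eq_self (fun y : EuclideanSpace ℝ (Fin d) =>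
    ENNReal.ofReal (2 ^ (j * d) * (1 + 2 ^ j * ‖y‖) ^ (-((d : ℝ) + 1)))) x]
  simp_rw [ENNReal.ofReal_mul (show (0 : ℝ) ≤ 2 ^ (j * d) by positivity)]
  rw [lintegral_const_mul' _ _ (by simp)]
  simp only [norm_smul, norm_pow, Real.norm_ofNat] at h3
  rw [← h3, smul_eq_mul, ← mul_assoc, ← ENNReal.ofReal_mul (by positivity),
    abs_of_nonneg (by positivity), finrank_euclideanSpace, Fintype.card_fin, ← pow_mul,
    mul_inv_cancel₀ (by positivity), ENNReal.ofReal_one, one_mul]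

lemma japaneseWeight_le {j : ℕ} {x y z : EuclideanSpace ℝ (Fin d)}
    (htx : (2 : ℝ) ^ j ≤ 1 ∨ (2 : ℝ) ^ j ≤ 2 * ‖x‖) (hy : y ∈ closedBall z (rho z)) :
    japaneseWeight j x y ≤ ENNReal.ofReal (10 ^ ((d : ℝ) + 1)) * japaneseWeight j x z := by
  have h := one_add_mul_norm_sub_le (one_le_pow₀ one_le_two) htx hy
  unfold japaneseWeight
  rw [← ENNReal.ofReal_mul (by positivity), mul_left_comm]
  refine ENNReal.ofReal_le_ofReal (mul_le_mul_of_nonneg_left ?_ (by positivity))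
  rw [Real.rpow_neg (by positivity), Real.rpow_neg (by positivity), ← div_eq_mul_inv,
    inv_eq_one_div, div_le_div_iff₀ (by positivity) (by positivity), one_mul,
    ← Real.mul_rpow (by positivity) (by positivity)]
  exact Real.rpow_le_rpow (by positivity) h (by positivity)

lemma exists_norm_phij_le (φ : SchwartzMap (EuclideanSpace ℝ (Fin d)) ℂ) :
    ∃ M : ℝ, 0 ≤ M ∧ ∀ (j : ℕ) (u : EuclideanSpace ℝ (Fin d)),
      ‖phij (⇑φ) j u‖ ≤
        M * (2 ^ (j * d) * (1 + 2 ^ j * ‖u‖) ^ (-((d : ℝ) + 1))) := by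
  obtain ⟨M, hM⟩ : ∃ M : ℝ, ∀ u, (1 + ‖u‖) ^ (d + 1) * ‖φ u‖ ≤ M :=
    ⟨_, fun u => by
      simpa using SchwartzMap.one_add_le_sup_seminorm_apply (𝕜 := ℝ) (m := (d + 1, 0))
        le_rfl le_rfl φ u⟩
  have hM0 : 0 ≤ M := le_trans (by positivity) (hM 0)
  refine ⟨M, hM0, fun j u => ?_⟩
  have h := hM ((2 : ℝ) ^ j • u)
  simp only [norm_smul, norm_pow, Real.norm_ofNat] at h
  have hr : (1 + 2 ^ j * ‖u‖) ^ (-((d : ℝ) + 1)) = ((1 + 2 ^ j * ‖u‖) ^ (d + 1))⁻¹ := by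
    rw [Real.rpow_neg (by positivity)]
    congr 1
    exact_mod_cast Real.rpow_natCast _ (d + 1)
  rw [hr, phij, norm_mul, norm_pow, Complex.norm_ofNat, mul_left_comm]
  gcongr
  rwa [← div_eq_mul_inv, le_div_iff₀ (by positivity), mul_comm]

end

/-- There is `C > 0` depending only on `d` and `φ` such that for every
`0 < ε < 1`, every `ε`-thin set `S`, every `N ≥ 0` and every `x`,
`∫_S |A_N(x,y)| dy ≤ C ε`. -/
theorem stmt8 {d : ℕ} (φ : SchwartzMap (EuclideanSpace ℝ (Fin d)) ℂ)
    (hrad : ∀ x y : EuclideanSpace ℝ (Fin d), ‖x‖ = ‖y‖ → φ x = φ y)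
    (him : ∀ ξ, (fourierInt (⇑φ) ξ).im = 0)
    (hre : ∀ ξ, 0 ≤ (fourierInt (⇑φ) ξ).re ∧ (fourierInt (⇑φ) ξ).re ≤ 1)
    (hsupp : ∀ ξ : EuclideanSpace ℝ (Fin d), 2 < ‖ξ‖ → fourierInt (⇑φ) ξ = 0)
    (hone : ∀ ξ : EuclideanSpace ℝ (Fin d), ‖ξ‖ ≤ 1 → fourierInt (⇑φ) ξ = 1)
    :
    ∃ C : ℝ, 0 < C ∧ ∀ ε : ℝ, 0 < ε → ε < 1 →
      ∀ S : Set (EuclideanSpace ℝ (Fin d)), IsThin ε S →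
      ∀ (N : ℕ) (x : EuclideanSpace ℝ (Fin d)),
        ∫⁻ y in S, (‖AN (⇑φ) N x y‖₊ : ℝ≥0∞) ≤ ENNReal.ofReal (C * ε) := by
  have hnorm : ∀ ξ, ‖fourierInt (⇑φ) ξ‖ ≤ 1 := fun ξ => by
    rw [← Complex.re_add_im (fourierInt (⇑φ) ξ), him ξ]
    simpa [abs_of_nonneg (hre ξ).1] using (hre ξ).2
  obtain ⟨M, hM0, hM⟩ := exists_norm_phij_le φ
  let I : ℝ≥0∞ := ∫⁻ u : EuclideanSpace ℝ (Fin d),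
    ENNReal.ofReal ((1 + ‖u‖) ^ (-((d : ℝ) + 1)))
  have hI : I ≠ ∞ := (finite_integral_one_add_norm (by simp)).ne
  let D : ℝ≥0∞ := 3 * (2 * (ENNReal.ofReal M *
    (4 ^ d * ENNReal.ofReal (10 ^ ((d : ℝ) + 1)) * I)))
  have hD : D ≠ ∞ := by
    have h4 : (4 : ℝ≥0∞) ^ d ≠ ∞ := by simp
    finiteness
  refine ⟨D.toReal + 1, by positivity, fun ε hε _ S hS N x => ?_⟩
  have hterm : ∀ j ∈ Finset.range (N + 1),
      ∫⁻ y in S, (‖psij (⇑φ) j x * phij (⇑φ) j (y - x)‖₊ : ℝ≥0∞) ≤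
        if psij (⇑φ) j x ≠ 0 then 2 * (ENNReal.ofReal M *
          (4 ^ d * ENNReal.ofReal (10 ^ ((d : ℝ) + 1)) * I)) * ENNReal.ofReal ε else 0 := by
    intro j _
    split_ifs with h0
    swap
    · simp [not_not.1 h0]
    have htx := (norm_bounds_of_psij_ne_zero hsupp hone h0).1
    calc ∫⁻ y in S, (‖psij (⇑φ) j x * phij (⇑φ) j (y - x)‖₊ : ℝ≥0∞)
        ≤ ∫⁻ y in S, 2 * ENNReal.ofReal M * japaneseWeight j x y := by
          refine lintegral_mono fun y => ?_
          simp only [nnnorm_mul, ENNReal.coe_mul, mul_assoc]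
          gcongr
          · exact_mod_cast norm_psij_le hnorm j x
          · rw [japaneseWeight, ← ENNReal.ofReal_mul hM0, ← enorm_eq_nnnorm, ← ofReal_norm]
            exact ENNReal.ofReal_le_ofReal (hM j (y - x))
      _ = 2 * ENNReal.ofReal M * ∫⁻ y in S, japaneseWeight j x y :=
          lintegral_const_mul _ (measurable_japaneseWeight j x)
      _ ≤ 2 * ENNReal.ofReal M * (4 ^ d * (ENNReal.ofReal (10 ^ ((d : ℝ) + 1)) *
            ENNReal.ofReal ε) * ∫⁻ y, japaneseWeight j x y) := by
          gcongr
          exact hS.setLIntegral_le (measurable_japaneseWeight j x)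
            fun z y hy => japaneseWeight_le htx hy
      _ = _ := by
          rw [lintegral_japaneseWeight]
          ring
  calc ∫⁻ y in S, (‖AN (⇑φ) N x y‖₊ : ℝ≥0∞)
      ≤ ∫⁻ y in S, ∑ j ∈ Finset.range (N + 1),
          (‖psij (⇑φ) j x * phij (⇑φ) j (y - x)‖₊ : ℝ≥0∞) := by
        refine lintegral_mono fun y => ?_
        rw [AN, ← ENNReal.ofNNReal_finsetSum]
        exact ENNReal.coe_le_coe.2 (nnnorm_sum_le _ _)
    _ = ∑ j ∈ Finset.range (N + 1),
          ∫⁻ y in S, (‖psij (⇑φ) j x * phij (⇑φ) j (y - x)‖₊ : ℝ≥0∞) := by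
        refine lintegral_finsetSum _ fun j _ => ?_
        have : Measurable fun y => phij (⇑φ) j (y - x) := by
          unfold phij
          have := φ.continuous
          exact Continuous.measurable (by fun_prop)
        fun_prop
    _ ≤ _ := Finset.sum_le_sum hterm
    _ = ({j ∈ Finset.range (N + 1) | psij (⇑φ) j x ≠ 0}.card : ℝ≥0∞) *
        (2 * (ENNReal.ofReal M *
          (4 ^ d * ENNReal.ofReal (10 ^ ((d : ℝ) + 1)) * I)) * ENNReal.ofReal ε) := by
        rw [← Finset.sum_filter, Finset.sum_const, nsmul_eq_mul]
    _ ≤ 3 * (2 * (ENNReal.ofReal M *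
          (4 ^ d * ENNReal.ofReal (10 ^ ((d : ℝ) + 1)) * I)) * ENNReal.ofReal ε) := by
        gcongr
        exact_mod_cast card_psij_ne_zero_le hsupp hone _ x
    _ = D * ENNReal.ofReal ε := by simp only [D]; ring
    _ ≤ ENNReal.ofReal ((D.toReal + 1) * ε) := by
        rw [ENNReal.ofReal_mul (by positivity)]
        gcongr
        rw [← ENNReal.ofReal_toReal hD]
        exact ENNReal.ofReal_le_ofReal (by simp)
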